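/- arXiv:0710.4022 — 4 statements merged into one kernel-verified Lean document; each statement's English description precedes it below -/
import Mathlib

section
/- For real x ∈ [0,1), (log²(1-x) + Li₂(x))/(1-x) = ∑_{n=1}^{∞} (H_n)² x^n. -/
/-- The dilogarithm, defined by its power series. -/
noncomputable def Li2 (x : ℝ) : ℝ := ∑' k : ℕ, x ^ (k + 1) / ((k : ℝ) + 1) ^ 2

open Finset

/-- The Cauchy product of the sequence `1 / (k + 1)` with itself. -/
lemma sum_range_one_div_mul_one_div (n : ℕ) :
    ∑ k ∈ range (n + 1), 1 / ((k : ℝ) + 1) * (1 / (((n - k : ℕ) : ℝ) + 1)) =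
      2 * (∑ k ∈ range (n + 1), 1 / ((k : ℝ) + 1)) / ((n : ℝ) + 2) := by
  have hrefl : ∑ k ∈ range (n + 1), 1 / (((n - k : ℕ) : ℝ) + 1) =
      ∑ k ∈ range (n + 1), 1 / ((k : ℝ) + 1) := by
    simpa using sum_range_reflect (fun k : ℕ => 1 / ((k : ℝ) + 1)) (n + 1)
  have hpartial : ∀ k ∈ range (n + 1), 1 / ((k : ℝ) + 1) * (1 / (((n - k : ℕ) : ℝ) + 1)) =
      (1 / ((k : ℝ) + 1) + 1 / (((n - k : ℕ) : ℝ) + 1)) / ((n : ℝ) + 2) := by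
    intro k hk
    obtain ⟨m, rfl⟩ := Nat.exists_eq_add_of_le (Nat.lt_succ_iff.mp (mem_range.mp hk))
    rw [Nat.add_sub_cancel_left]
    push_cast
    have : (k : ℝ) + m + 2 ≠ 0 := by positivity
    field_simp
    ring
  rw [sum_congr rfl hpartial, ← sum_div, sum_add_distrib, hrefl, two_mul]

/-- The square of a harmonic number as a telescoping sum. -/
lemma sum_range_harmonic_sq_increment (n : ℕ) :
    ∑ m ∈ range n, (2 * (∑ k ∈ range m, 1 / ((k : ℝ) + 1)) / ((m : ℝ) + 1) +
      1 / ((m : ℝ) + 1) ^ 2) = (∑ k ∈ range n, 1 / ((k : ℝ) + 1)) ^ 2 := by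
  induction n with
  | zero => simp
  | succ n ih =>
    rw [sum_range_succ, ih, sum_range_succ, ← one_div_pow]
    ring

/-- The power series of `log (1 - x) ^ 2`. -/
lemma hasSum_log_one_sub_sq {x : ℝ} (hx : |x| < 1) :
    HasSum (fun n : ℕ => 2 * (∑ k ∈ range n, 1 / ((k : ℝ) + 1)) / ((n : ℝ) + 1) * x ^ (n + 1))
      (Real.log (1 - x) ^ 2) := by
  have hlog := Real.hasSum_pow_div_log_of_abs_lt_one hx
  have hnorm : Summable fun n : ℕ => ‖x ^ (n + 1) / ((n : ℝ) + 1)‖ := by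
    have := (Real.hasSum_pow_div_log_of_abs_lt_one (x := |x|) (by simpa using hx)).summable
    refine this.congr fun n => ?_
    rw [norm_div, norm_pow, Real.norm_eq_abs, Real.norm_of_nonneg (by positivity)]
  have hmul := hasSum_sum_range_mul_of_summable_norm hnorm hnorm
  rw [hlog.tsum_eq] at hmul
  rw [← hasSum_nat_add_iff' 1]
  convert! hmul using 1
  · funext n
    have hterm : ∀ k ∈ range (n + 1),
        x ^ (k + 1) / ((k : ℝ) + 1) * (x ^ (n - k + 1) / (((n - k : ℕ) : ℝ) + 1)) =
        1 / ((k : ℝ) + 1) * (1 / (((n - k : ℕ) : ℝ) + 1)) * x ^ (n + 2) := by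
      intro k hk
      have hexp : n + 2 = (k + 1) + (n - k + 1) := by
        have := mem_range.mp hk
        lia
      rw [hexp, pow_add]
      ring
    rw [sum_congr rfl hterm, ← sum_mul, sum_range_one_div_mul_one_div]
    push_cast
    ring
  · simp
    ring

lemma hasSum_Li2 {x : ℝ} (hx : |x| < 1) :
    HasSum (fun n : ℕ => 1 / ((n : ℝ) + 1) ^ 2 * x ^ (n + 1)) (Li2 x) := by
  have hsum : Summable fun n : ℕ => x ^ (n + 1) / ((n : ℝ) + 1) ^ 2 := by
    refine Summable.of_norm_bounded
      ((summable_nat_add_iff 1).mpr (summable_geometric_of_lt_one (abs_nonneg x) hx)) fun n => ?_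
    rw [norm_div, norm_pow, Real.norm_eq_abs, Real.norm_of_nonneg (by positivity)]
    exact div_le_self (by positivity) (one_le_pow₀ (by linarith [n.cast_nonneg (α := ℝ)]))
  convert! hsum.hasSum using 2
  ring

theorem harmonic_sq_generating_function (x : ℝ) (hx0 : 0 ≤ x) (hx1 : x < 1) :
    HasSum (fun n : ℕ =>
        (∑ k ∈ Finset.Icc 1 (n + 1), (1 : ℝ) / k) ^ 2 * x ^ (n + 1))
      (((Real.log (1 - x)) ^ 2 + Li2 x) / (1 - x)) := by
  have hx : |x| < 1 := by rwa [abs_of_nonneg hx0]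
  have hadd := (hasSum_log_one_sub_sq hx).add (hasSum_Li2 hx)
  have hmul := hasSum_sum_range_mul_of_summable_norm hadd.summable.norm
    (summable_geometric_of_lt_one hx0 hx1).norm
  rw [hadd.tsum_eq, tsum_geometric_of_lt_one hx0 hx1, ← div_eq_mul_inv] at hmul
  convert! hmul using 1
  funext n
  have hterm : ∀ m ∈ range (n + 1),
      (2 * (∑ k ∈ range m, 1 / ((k : ℝ) + 1)) / ((m : ℝ) + 1) * x ^ (m + 1) +
        1 / ((m : ℝ) + 1) ^ 2 * x ^ (m + 1)) * x ^ (n - m) =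
      (2 * (∑ k ∈ range m, 1 / ((k : ℝ) + 1)) / ((m : ℝ) + 1) +
        1 / ((m : ℝ) + 1) ^ 2) * x ^ (n + 1) := by
    intro m hm
    have hexp : n + 1 = (m + 1) + (n - m) := by
      have := mem_range.mp hm
      lia
    rw [hexp, pow_add]
    ring
  have hIcc : ∑ k ∈ Icc 1 (n + 1), (1 : ℝ) / k = ∑ k ∈ range (n + 1), 1 / ((k : ℝ) + 1) := by
    rw [range_eq_Ico, ← Ico_add_one_right_eq_Icc, ← sum_Ico_add' _ 0 (n + 1) 1]
    simp
  rw [sum_congr rfl hterm, ← sum_mul, sum_range_harmonic_sq_increment, hIcc]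
end

section
/- The series ∑_{n=1}^{∞} (H_n)²/(n 2^n) converges and equals (7/8) ζ(3). -/
open Real Set MeasureTheory

/-- A change of variables by a bijection of the open unit interval. -/
lemma integral_unit_comp {φ φ' g h : ℝ → ℝ} (ψ : ℝ → ℝ)
    (hφ : ∀ x ∈ Ioo (0 : ℝ) 1, HasDerivAt φ (φ' x) x)
    (hmaps : MapsTo φ (Ioo 0 1) (Ioo 0 1)) (hψ : MapsTo ψ (Ioo 0 1) (Ioo 0 1))
    (hleft : LeftInvOn ψ φ (Ioo 0 1)) (hright : RightInvOn ψ φ (Ioo 0 1))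
    (hh : ∀ x ∈ Ioo (0 : ℝ) 1, |φ' x| * g (φ x) = h x)
    (hg : IntegrableOn g (Ioo 0 1)) :
    IntegrableOn h (Ioo 0 1) ∧ ∫ x in Ioo 0 1, h x = ∫ x in Ioo 0 1, g x := by
  have himage : φ '' Ioo 0 1 = Ioo 0 1 :=
    Subset.antisymm hmaps.image_subset fun x hx => ⟨ψ x, hψ hx, hright hx⟩
  have hderiv : ∀ x ∈ Ioo (0 : ℝ) 1, HasDerivWithinAt φ (φ' x) (Ioo 0 1) x :=
    fun x hx => (hφ x hx).hasDerivWithinAt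
  constructor
  · have key := integrableOn_image_iff_integrableOn_abs_deriv_smul measurableSet_Ioo hderiv
      hleft.injOn g
    rw [himage] at key
    exact (key.mp hg).congr_fun (fun x hx => by simpa using hh x hx) measurableSet_Ioo
  · have key := integral_image_eq_integral_abs_deriv_smul measurableSet_Ioo hderiv
      hleft.injOn g
    rw [himage] at key
    rw [key]
    exact setIntegral_congr_fun measurableSet_Ioo fun x hx => by simpa using (hh x hx).symm

/-- Termwise integration of a series of nonnegative functions with integrable sum. -/
lemma hasSum_setIntegral_of_nonneg {α : Type*} [MeasurableSpace α] {μ : Measure α} {s : Set α}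
    (hs : MeasurableSet s) {F : ℕ → α → ℝ} {f : α → ℝ}
    (hF : ∀ n, AEStronglyMeasurable (F n) (μ.restrict s)) (hpos : ∀ n, ∀ x ∈ s, 0 ≤ F n x)
    (hsum : ∀ x ∈ s, HasSum (fun n => F n x) (f x)) (hf : IntegrableOn f s μ) :
    HasSum (fun n => ∫ x in s, F n x ∂μ) (∫ x in s, f x ∂μ) := by
  refine hasSum_integral_of_dominated_convergence F hF (fun n => ?_) ?_ ?_ ?_
  · filter_upwards [ae_restrict_mem hs] with x hx
    rw [Real.norm_of_nonneg (hpos n x hx)]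
  · filter_upwards [ae_restrict_mem hs] with x hx using (hsum x hx).summable
  · exact hf.congr_fun (fun x hx => (hsum x hx).tsum_eq.symm) hs
  · filter_upwards [ae_restrict_mem hs] with x hx using hsum x hx

lemma setIntegral_unit_eq_sub {F f : ℝ → ℝ} (hF : ContinuousOn F (Icc 0 1))
    (hderiv : ∀ x ∈ Ioo (0 : ℝ) 1, HasDerivAt F (f x) x) (hf : IntegrableOn f (Ioo 0 1)) :
    ∫ x in Ioo 0 1, f x = F 1 - F 0 := by
  rw [← integral_Ioc_eq_integral_Ioo, ← intervalIntegral.integral_of_le zero_le_one]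
  exact intervalIntegral.integral_eq_sub_of_hasDerivAt_of_le zero_le_one hF hderiv
    ((intervalIntegrable_iff_integrableOn_Ioo_of_le zero_le_one).mpr hf)

lemma continuousOn_mul_log_sq : ContinuousOn (fun x : ℝ => x * log x ^ 2) (Icc 0 1) := by
  have h : Continuous fun x : ℝ => 4 * (√x * log √x) ^ 2 :=
    ((continuous_mul_log.comp continuous_sqrt).pow 2).const_mul 4
  refine h.continuousOn.congr fun x hx => ?_
  simp only [log_sqrt hx.1, mul_pow, sq_sqrt hx.1]
  ring

lemma integrableOn_log_unit : IntegrableOn log (Ioo 0 1) :=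
  (intervalIntegrable_iff_integrableOn_Ioo_of_le zero_le_one).mp
    intervalIntegral.intervalIntegrable_log'

lemma integrableOn_log_sq_unit : IntegrableOn (fun x : ℝ => log x ^ 2) (Ioo 0 1) := by
  refine (intervalIntegral.integrableOn_deriv_of_nonneg
    (g := fun x => x * log x ^ 2 - 2 * (x * log x) + 2 * x) ?_ ?_ ?_).mono_set Ioo_subset_Ioc_self
  · exact (continuousOn_mul_log_sq.sub (continuous_mul_log.const_mul 2).continuousOn).add
      (by fun_prop)
  · intro x hx
    have hx0 : x ≠ 0 := hx.1.ne'
    have hl := hasDerivAt_log hx0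
    have hid := hasDerivAt_id' x
    refine (((hid.mul (hl.pow 2)).sub ((hid.mul hl).const_mul 2)).add
      (hid.const_mul 2)).congr_deriv ?_
    simp only [Pi.pow_apply]
    field_simp
    ring
  · intro x _
    positivity

/-- A continuous factor preserves integrability on the open unit interval. -/
lemma integrableOn_unit_continuous_mul {p f : ℝ → ℝ} (hp : Continuous p)
    (hf : IntegrableOn f (Ioo 0 1)) : IntegrableOn (fun x => p x * f x) (Ioo 0 1) :=
  (((integrableOn_Icc_iff_integrableOn_Ioo).mpr hf).continuousOn_mul hp.continuousOn
    isCompact_Icc).mono_set Ioo_subset_Icc_self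

lemma integral_pow_mul_log (n : ℕ) :
    ∫ x in Ioo (0 : ℝ) 1, x ^ n * log x = -(1 / ((n : ℝ) + 1) ^ 2) := by
  have hn : (n : ℝ) + 1 ≠ 0 := by positivity
  rw [setIntegral_unit_eq_sub
    (F := fun x => x ^ n * (x * log x) / (n + 1) - x ^ (n + 1) / ((n : ℝ) + 1) ^ 2) ?_ ?_
    (integrableOn_unit_continuous_mul (continuous_pow n) integrableOn_log_unit)]
  · simp
  · have := continuous_mul_log
    fun_prop
  · intro x hx
    have hx0 : x ≠ 0 := hx.1.ne'
    have hp := hasDerivAt_pow (n + 1) x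
    have h := ((hp.mul (hasDerivAt_log hx0)).div_const ((n : ℝ) + 1)).sub
      (hp.div_const (((n : ℝ) + 1) ^ 2))
    refine (h.congr_deriv ?_).congr_of_eventuallyEq (.of_forall fun y => ?_)
    · simp only [add_tsub_cancel_right]
      push_cast
      field_simp
      ring
    · simp only [Pi.sub_apply, Pi.mul_apply]
      ring

lemma integral_pow_mul_log_sq (n : ℕ) :
    ∫ x in Ioo (0 : ℝ) 1, x ^ n * log x ^ 2 = 2 / ((n : ℝ) + 1) ^ 3 := by
  have hn : (n : ℝ) + 1 ≠ 0 := by positivity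
  have hint := integrableOn_unit_continuous_mul (continuous_pow n) integrableOn_log_unit
  have hint2 := integrableOn_unit_continuous_mul (continuous_pow n) integrableOn_log_sq_unit
  have h0 : ∫ x in Ioo (0 : ℝ) 1, ((n + 1) * (x ^ n * log x ^ 2) + 2 * (x ^ n * log x)) = 0 := by
    rw [setIntegral_unit_eq_sub (F := fun x => x ^ n * (x * log x ^ 2)) ?_ ?_
      ((hint2.const_mul _).fun_add (hint.const_mul _))]
    · simp
    · exact (continuous_pow n).continuousOn.mul continuousOn_mul_log_sq
    · intro x hx
      have hx0 : x ≠ 0 := hx.1.ne'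
      have h := (hasDerivAt_pow (n + 1) x).mul ((hasDerivAt_log hx0).pow 2)
      refine (h.congr_deriv ?_).congr_of_eventuallyEq (.of_forall fun y => ?_)
      · simp only [add_tsub_cancel_right, Pi.pow_apply]
        push_cast
        field_simp
        ring
      · simp only [Pi.mul_apply, Pi.pow_apply]
        ring
  rw [integral_add (hint2.const_mul _) (hint.const_mul _), integral_const_mul, integral_const_mul,
    integral_pow_mul_log] at h0
  field_simp at h0 ⊢
  linarith

lemma integral_one_sub_pow_mul_log (n : ℕ) :
    ∫ x in Ioo (0 : ℝ) 1, (1 - x) ^ n * log x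
      = -((∑ k ∈ Finset.Icc 1 (n + 1), (1 : ℝ) / k) / (n + 1)) := by
  have hint (m : ℕ) : IntegrableOn (fun x : ℝ => (1 - x) ^ m * log x) (Ioo 0 1) :=
    integrableOn_unit_continuous_mul (by fun_prop) integrableOn_log_unit
  induction n with
  | zero => simpa using integral_pow_mul_log 0
  | succ n ih =>
    have hone : IntegrableOn (fun x : ℝ => (1 - x) ^ (n + 1)) (Ioo 0 1) :=
      (Continuous.integrableOn_Icc (by fun_prop)).mono_set Ioo_subset_Icc_self
    have hpow : ∫ x in Ioo (0 : ℝ) 1, (1 - x) ^ (n + 1) = 1 / ((n : ℝ) + 2) := by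
      rw [← integral_Ioc_eq_integral_Ioo, ← intervalIntegral.integral_of_le zero_le_one,
        intervalIntegral.integral_comp_sub_left (fun x => x ^ (n + 1)), integral_pow]
      simp; ring
    have h0 : ∫ x in Ioo (0 : ℝ) 1, (((n + 2) * ((1 - x) ^ (n + 1) * log x)
        - (n + 1) * ((1 - x) ^ n * log x)) + (1 - x) ^ (n + 1)) = 0 := by
      rw [setIntegral_unit_eq_sub (F := fun x => (1 - x) ^ (n + 1) * (x * log x)) ?_ ?_
        ((((hint _).const_mul _).sub' ((hint _).const_mul _)).fun_add hone)]
      · simp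
      · have := continuous_mul_log
        fun_prop
      · intro x hx
        have hx0 : x ≠ 0 := hx.1.ne'
        have h := (((hasDerivAt_id' x).const_sub 1).pow (n + 1)).mul
          ((hasDerivAt_id' x).mul (hasDerivAt_log hx0))
        refine h.congr_deriv ?_
        simp only [add_tsub_cancel_right, Pi.mul_apply, Pi.pow_apply]
        push_cast
        field_simp
        ring
    rw [integral_add (((hint _).const_mul _).sub' ((hint _).const_mul _)) hone,
      integral_sub ((hint _).const_mul _) ((hint _).const_mul _), integral_const_mul,
      integral_const_mul, ih, hpow] at h0
    rw [Finset.sum_Icc_succ_top (by omega)]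
    push_cast
    have hn : (n : ℝ) + 1 ≠ 0 := by positivity
    have hn2 : (n : ℝ) + 2 ≠ 0 := by positivity
    rw [show (n : ℝ) + 1 + 1 = n + 2 by ring]
    field_simp at h0 ⊢
    linarith

lemma integral_one_sub_pow_mul_log_sq (n : ℕ) :
    ∫ x in Ioo (0 : ℝ) 1, (1 - x) ^ n * log x ^ 2
      = ((∑ k ∈ Finset.Icc 1 (n + 1), (1 : ℝ) / k) ^ 2
        + ∑ k ∈ Finset.Icc 1 (n + 1), (1 : ℝ) / (k : ℝ) ^ 2) / (n + 1) := by
  have hint (m : ℕ) : IntegrableOn (fun x : ℝ => (1 - x) ^ m * log x) (Ioo 0 1) :=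
    integrableOn_unit_continuous_mul (by fun_prop) integrableOn_log_unit
  have hint2 (m : ℕ) : IntegrableOn (fun x : ℝ => (1 - x) ^ m * log x ^ 2) (Ioo 0 1) :=
    integrableOn_unit_continuous_mul (by fun_prop) integrableOn_log_sq_unit
  induction n with
  | zero =>
    have h := integral_pow_mul_log_sq 0
    norm_num at h ⊢
    exact h
  | succ n ih =>
    have h0 : ∫ x in Ioo (0 : ℝ) 1, (((n + 2) * ((1 - x) ^ (n + 1) * log x ^ 2)
        - (n + 1) * ((1 - x) ^ n * log x ^ 2)) + 2 * ((1 - x) ^ (n + 1) * log x)) = 0 := by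
      rw [setIntegral_unit_eq_sub (F := fun x => (1 - x) ^ (n + 1) * (x * log x ^ 2)) ?_ ?_
        ((((hint2 _).const_mul _).sub' ((hint2 _).const_mul _)).fun_add ((hint _).const_mul _))]
      · simp
      · exact ContinuousOn.mul (by fun_prop) continuousOn_mul_log_sq
      · intro x hx
        have hx0 : x ≠ 0 := hx.1.ne'
        have h := (((hasDerivAt_id' x).const_sub 1).pow (n + 1)).mul
          ((hasDerivAt_id' x).mul ((hasDerivAt_log hx0).pow 2))
        refine h.congr_deriv ?_
        simp only [add_tsub_cancel_right, Pi.mul_apply, Pi.pow_apply]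
        push_cast
        field_simp
        ring
    rw [integral_add (((hint2 _).const_mul _).sub' ((hint2 _).const_mul _)) ((hint _).const_mul _),
      integral_sub ((hint2 _).const_mul _) ((hint2 _).const_mul _), integral_const_mul,
      integral_const_mul, integral_const_mul, ih, integral_one_sub_pow_mul_log] at h0
    rw [Finset.sum_Icc_succ_top (b := n + 1) (by omega)] at h0 ⊢
    rw [Finset.sum_Icc_succ_top (b := n + 1) (by omega)]
    push_cast at h0 ⊢
    have hn : (n : ℝ) + 1 ≠ 0 := by positivity
    have hn2 : (n : ℝ) + 2 ≠ 0 := by positivity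
    rw [show (n : ℝ) + 1 + 1 = n + 2 by ring] at h0 ⊢
    field_simp at h0 ⊢
    linear_combination h0

lemma integrableOn_log_sq_div_one_sub :
    IntegrableOn (fun x : ℝ => log x ^ 2 / (1 - x)) (Ioo 0 1) := by
  refine Integrable.mono' (integrableOn_log_sq_unit.sub' integrableOn_log_unit)
    (Measurable.aestronglyMeasurable (by fun_prop)) ?_
  filter_upwards [ae_restrict_mem measurableSet_Ioo] with x hx
  have hx1 : 0 < 1 - x := sub_pos.mpr hx.2
  have hlog : log x ≤ 0 := log_nonpos hx.1.le hx.2.le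
  have hbound : x - 1 ≤ x * log x := by
    have h := mul_le_mul_of_nonneg_left (one_sub_inv_le_log_of_pos hx.1) hx.1.le
    rwa [mul_sub, mul_one, mul_inv_cancel₀ hx.1.ne'] at h
  rw [Real.norm_of_nonneg (by positivity), div_le_iff₀ hx1]
  nlinarith

lemma integral_log_sq_div_one_add :
    IntegrableOn (fun x : ℝ => log x ^ 2 / (1 + x)) (Ioo 0 1) ∧
      ∫ x in Ioo (0 : ℝ) 1, log x ^ 2 / (1 + x)
        = 3 / 4 * ∫ x in Ioo (0 : ℝ) 1, log x ^ 2 / (1 - x) := by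
  have hQ := integrableOn_log_sq_div_one_sub
  obtain ⟨hS, hS'⟩ := integral_unit_comp (φ := fun x => x ^ 2) (φ' := fun x => 2 * x)
    (h := fun x => 8 * x * log x ^ 2 / (1 - x ^ 2)) (fun x => √x)
    (fun x _ => by simpa using hasDerivAt_pow 2 x)
    (fun x hx => ⟨by have := hx.1; positivity, by have := hx.1; have := hx.2; nlinarith⟩)
    (fun x hx => ⟨sqrt_pos.mpr hx.1, by rw [sqrt_lt' one_pos]; simpa using hx.2⟩)
    (fun x hx => sqrt_sq hx.1.le) (fun x hx => sq_sqrt hx.1.le)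
    (fun x hx => by
      have := hx.1
      rw [abs_of_pos (by positivity), log_pow]
      push_cast
      ring) hQ
  have hP : EqOn (fun x : ℝ => log x ^ 2 / (1 - x) - 1 / 4 * (8 * x * log x ^ 2 / (1 - x ^ 2)))
      (fun x => log x ^ 2 / (1 + x)) (Ioo 0 1) := by
    intro x hx
    have h1 : 1 - x ≠ 0 := (sub_pos.mpr hx.2).ne'
    have h2 : 1 + x ≠ 0 := by have := hx.1; positivity
    simp only [show 1 - x ^ 2 = (1 - x) * (1 + x) by ring]
    field_simp
    ring
  refine ⟨IntegrableOn.congr_fun (hQ.sub' (hS.const_mul (1 / 4))) hP measurableSet_Ioo, ?_⟩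
  rw [← setIntegral_congr_fun measurableSet_Ioo hP, integral_sub hQ (hS.const_mul (1 / 4)),
    integral_const_mul, hS']
  ring

lemma integral_log_one_sub_sq_sq_div :
    IntegrableOn (fun x : ℝ => 2 * log (1 - x ^ 2) ^ 2 / x) (Ioo 0 1) ∧
      ∫ x in Ioo (0 : ℝ) 1, 2 * log (1 - x ^ 2) ^ 2 / x
        = ∫ x in Ioo (0 : ℝ) 1, log x ^ 2 / (1 - x) := by
  refine integral_unit_comp (φ := fun x => 1 - x ^ 2) (φ' := fun x => -(2 * x))
    (fun x => √(1 - x)) (fun x _ => by simpa using (hasDerivAt_pow 2 x).const_sub 1)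
    (fun x hx => ?_) (fun x hx => ?_) (fun x hx => ?_) (fun x hx => ?_) (fun x hx => ?_)
    integrableOn_log_sq_div_one_sub
  · obtain ⟨h0, h1⟩ := hx
    exact ⟨by nlinarith, by nlinarith⟩
  · obtain ⟨h0, h1⟩ := hx
    exact ⟨sqrt_pos.mpr (by linarith), by rw [sqrt_lt' one_pos]; linarith⟩
  · simp [sqrt_sq hx.1.le]
  · simp [sq_sqrt (sub_nonneg.mpr hx.2.le)]
  · have h0 := hx.1
    rw [abs_neg, abs_of_pos (by positivity), sub_sub_cancel]
    field_simp

lemma integral_log_one_sub_div_one_add_sq_div :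
    IntegrableOn (fun x : ℝ => log ((1 - x) / (1 + x)) ^ 2 / x) (Ioo 0 1) ∧
      ∫ x in Ioo (0 : ℝ) 1, log ((1 - x) / (1 + x)) ^ 2 / x
        = 7 / 4 * ∫ x in Ioo (0 : ℝ) 1, log x ^ 2 / (1 - x) := by
  have hQ := integrableOn_log_sq_div_one_sub
  obtain ⟨hP, hP'⟩ := integral_log_sq_div_one_add
  have hmaps : MapsTo (fun x : ℝ => (1 - x) / (1 + x)) (Ioo 0 1) (Ioo 0 1) := by
    rintro x ⟨h0, h1⟩
    have h2 : 0 < 1 + x := by linarith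
    exact ⟨div_pos (by linarith) h2, by rw [div_lt_one h2]; linarith⟩
  have hinv : LeftInvOn (fun x : ℝ => (1 - x) / (1 + x)) (fun x => (1 - x) / (1 + x))
      (Ioo 0 1) := by
    intro x hx
    have h2 : 1 + x ≠ 0 := by have := hx.1; positivity
    have h3 : 1 + (1 - x) / (1 + x) ≠ 0 := by have := (hmaps hx).1; positivity
    field_simp
    ring
  have key := integral_unit_comp (φ := fun x => (1 - x) / (1 + x))
    (φ' := fun x => -(2 / (1 + x) ^ 2)) (h := fun x => log ((1 - x) / (1 + x)) ^ 2 / x) _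
    (fun x hx => ?_) hmaps hmaps hinv hinv (fun x hx => ?_) (hQ.fun_add hP)
  · refine ⟨key.1, ?_⟩
    rw [key.2, integral_add hQ hP, hP']
    ring
  · have h2 : 1 + x ≠ 0 := by have := hx.1; positivity
    refine (((hasDerivAt_id' x).const_sub 1).div ((hasDerivAt_id' x).const_add 1)
      h2).congr_deriv ?_
    ring
  · have h0 := hx.1
    have h0' : x ≠ 0 := h0.ne'
    have h2 : 1 + x ≠ 0 := by positivity
    rw [abs_neg, abs_of_pos (by positivity),
      show 1 - (1 - x) / (1 + x) = 2 * x / (1 + x) by field_simp; ring,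
      show 1 + (1 - x) / (1 + x) = 2 / (1 + x) by field_simp; ring]
    field_simp

lemma integral_neg_log_mul_log_two_sub_div :
    IntegrableOn (fun x : ℝ => -log x * log (2 - x) / (1 - x)) (Ioo 0 1) ∧
      ∫ x in Ioo (0 : ℝ) 1, -log x * log (2 - x) / (1 - x)
        = 5 / 16 * ∫ x in Ioo (0 : ℝ) 1, log x ^ 2 / (1 - x) := by
  obtain ⟨hA, hA'⟩ := integral_log_one_sub_sq_sq_div
  obtain ⟨hD, hD'⟩ := integral_log_one_sub_div_one_add_sq_div
  have hR := (hD.const_mul (1 / 4)).sub' (hA.const_mul (1 / 8))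
  have hmaps : MapsTo (fun x : ℝ => 1 - x) (Ioo 0 1) (Ioo 0 1) :=
    fun x hx => ⟨sub_pos.mpr hx.2, sub_lt_self _ hx.1⟩
  have hinv : LeftInvOn (fun x : ℝ => 1 - x) (fun x => 1 - x) (Ioo 0 1) :=
    fun x _ => sub_sub_cancel 1 x
  have key := integral_unit_comp (φ := fun x => 1 - x) (φ' := fun _ => -1)
    (h := fun x => -log x * log (2 - x) / (1 - x)) _
    (fun x _ => (hasDerivAt_id' x).const_sub 1) hmaps hmaps hinv hinv (fun x hx => ?_) hR
  · refine ⟨key.1, ?_⟩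
    rw [key.2, integral_sub (hD.const_mul _) (hA.const_mul _), integral_const_mul,
      integral_const_mul, hA', hD']
    ring
  · have h0 : x ≠ 0 := hx.1.ne'
    have h1 : 1 - x ≠ 0 := (sub_pos.mpr hx.2).ne'
    have h2 : 2 - x ≠ 0 := by have := hx.2; linarith
    rw [show 1 - (1 - x) ^ 2 = x * (2 - x) by ring, sub_sub_cancel,
      show 1 + (1 - x) = 2 - x by ring, log_mul h0 h2, log_div h0 h2]
    simp only [abs_neg, abs_one]
    field_simp
    ring

lemma hasSum_integral_log_sq_div_one_sub :
    HasSum (fun n : ℕ => 2 / ((n : ℝ) + 1) ^ 3)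
      (∫ x in Ioo (0 : ℝ) 1, log x ^ 2 / (1 - x)) := by
  simp_rw [← integral_pow_mul_log_sq]
  refine hasSum_setIntegral_of_nonneg measurableSet_Ioo
    (fun n => Measurable.aestronglyMeasurable (by fun_prop))
    (fun n x hx => by have := hx.1; positivity) (fun x hx => ?_) integrableOn_log_sq_div_one_sub
  rw [div_eq_inv_mul]
  exact (hasSum_geometric_of_lt_one hx.1.le hx.2).mul_right _

lemma hasSum_integral_log_sq_div_one_add :
    HasSum (fun n : ℕ => ((∑ k ∈ Finset.Icc 1 (n + 1), (1 : ℝ) / k) ^ 2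
        + ∑ k ∈ Finset.Icc 1 (n + 1), (1 : ℝ) / (k : ℝ) ^ 2) / (((n : ℝ) + 1) * 2 ^ (n + 1)))
      (∫ x in Ioo (0 : ℝ) 1, log x ^ 2 / (1 + x)) := by
  have hterm (n : ℕ) : ((∑ k ∈ Finset.Icc 1 (n + 1), (1 : ℝ) / k) ^ 2
        + ∑ k ∈ Finset.Icc 1 (n + 1), (1 : ℝ) / (k : ℝ) ^ 2) / (((n : ℝ) + 1) * 2 ^ (n + 1))
      = ∫ x in Ioo (0 : ℝ) 1, 1 / 2 ^ (n + 1) * ((1 - x) ^ n * log x ^ 2) := by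
    rw [integral_const_mul, integral_one_sub_pow_mul_log_sq]
    field_simp
  simp_rw [hterm]
  refine hasSum_setIntegral_of_nonneg measurableSet_Ioo
    (fun n => Measurable.aestronglyMeasurable (by fun_prop))
    (fun n x hx => by have := sub_pos.mpr hx.2; positivity) (fun x hx => ?_)
    integral_log_sq_div_one_add.1
  obtain ⟨h0, h1⟩ := hx
  have hgeom := (hasSum_geometric_of_lt_one (r := (1 - x) / 2) (by linarith)
    (by linarith)).mul_right (log x ^ 2 / 2)
  rw [show (1 - (1 - x) / 2)⁻¹ * (log x ^ 2 / 2) = log x ^ 2 / (1 + x) by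
    rw [show 1 - (1 - x) / 2 = (1 + x) / 2 by ring]
    field_simp] at hgeom
  refine hgeom.congr_fun fun n => ?_
  rw [div_pow, pow_succ]
  ring

lemma sum_Icc_one_div_sq_eq_integral (n : ℕ) :
    ∑ k ∈ Finset.Icc 1 (n + 1), (1 : ℝ) / (k : ℝ) ^ 2
      = ∫ x in Ioo (0 : ℝ) 1, -log x * (1 - x ^ (n + 1)) / (1 - x) := by
  have hsum : EqOn (fun x : ℝ => ∑ k ∈ Finset.range (n + 1), -(x ^ k * log x))
      (fun x => -log x * (1 - x ^ (n + 1)) / (1 - x)) (Ioo 0 1) := by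
    intro x hx
    have h1 : 1 - x ≠ 0 := (sub_pos.mpr hx.2).ne'
    simp only
    rw [eq_div_iff h1, Finset.sum_neg_distrib, ← Finset.sum_mul, ← geom_sum_mul_neg x (n + 1)]
    ring
  rw [← setIntegral_congr_fun measurableSet_Ioo hsum, integral_finsetSum _ fun k _ =>
    (integrableOn_unit_continuous_mul (continuous_pow k) integrableOn_log_unit).fun_neg]
  simp_rw [integral_neg, integral_pow_mul_log, neg_neg]
  rw [Finset.range_eq_Ico, ← Finset.Ico_add_one_right_eq_Icc, ← zero_add 1,
    ← Finset.sum_Ico_add']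
  simp

lemma hasSum_integral_neg_log_mul_log_two_sub_div :
    HasSum (fun n : ℕ => (∑ k ∈ Finset.Icc 1 (n + 1), (1 : ℝ) / (k : ℝ) ^ 2)
        / (((n : ℝ) + 1) * 2 ^ (n + 1)))
      (∫ x in Ioo (0 : ℝ) 1, -log x * log (2 - x) / (1 - x)) := by
  simp_rw [sum_Icc_one_div_sq_eq_integral, ← integral_div]
  refine hasSum_setIntegral_of_nonneg measurableSet_Ioo
    (fun n => Measurable.aestronglyMeasurable (by fun_prop))
    (fun n x hx => ?_) (fun x hx => ?_) integral_neg_log_mul_log_two_sub_div.1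
  · have h1 := sub_pos.mpr hx.2
    have h2 : 0 ≤ 1 - x ^ (n + 1) := sub_nonneg.mpr (pow_le_one₀ hx.1.le hx.2.le)
    have h3 : 0 ≤ -log x := neg_nonneg.mpr (log_nonpos hx.1.le hx.2.le)
    positivity
  · obtain ⟨h0, h1⟩ := hx
    have hhalf := hasSum_pow_div_log_of_abs_lt_one (x := 1 / 2) (by norm_num [abs_lt])
    have hx2 := hasSum_pow_div_log_of_abs_lt_one (x := x / 2)
      (by rw [abs_lt]; constructor <;> linarith)
    have h := (hhalf.sub hx2).mul_left (-log x / (1 - x))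
    have hlog : -log (1 - 1 / 2) - -log (1 - x / 2) = log (2 - x) := by
      rw [show 1 - x / 2 = (1 - 1 / 2) * (2 - x) by ring,
        log_mul (by norm_num) (by linarith)]
      ring
    rw [hlog, div_mul_eq_mul_div] at h
    refine h.congr_fun fun n => ?_
    rw [div_pow, div_pow, one_pow]
    have h2 : 1 - x ≠ 0 := by linarith
    field_simp

theorem harmonic_sq_over_n_two_pow :
    HasSum (fun n : ℕ =>
        (∑ k ∈ Finset.Icc 1 (n + 1), (1 : ℝ) / k) ^ 2
          / (((n : ℝ) + 1) * 2 ^ (n + 1)))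
      ((7 / 8) * ∑' n : ℕ, 1 / ((n : ℝ) + 1) ^ 3) := by
  have hzeta := (hasSum_integral_log_sq_div_one_sub.div_const 2).tsum_eq
  simp only [div_right_comm _ _ (2 : ℝ), div_self (two_ne_zero' ℝ)] at hzeta
  have h := hasSum_integral_log_sq_div_one_add.sub hasSum_integral_neg_log_mul_log_two_sub_div
  rw [integral_log_sq_div_one_add.2, integral_neg_log_mul_log_two_sub_div.2] at h
  rw [hzeta, show (7 / 8 : ℝ) * ((∫ x in Ioo (0 : ℝ) 1, log x ^ 2 / (1 - x)) / 2)
    = 3 / 4 * (∫ x in Ioo (0 : ℝ) 1, log x ^ 2 / (1 - x))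
      - 5 / 16 * ∫ x in Ioo (0 : ℝ) 1, log x ^ 2 / (1 - x) by ring]
  exact h.congr_fun fun n => by ring
end

section
/- The series ∑_{n=1}^{∞} H_n^{(2)}/(n 2^n) converges and equals (5/8) ζ(3), where H_n^{(2)} = ∑_{j=1}^n 1/j². -/
open Set Filter

/-- The polylogarithm `∑ x ^ n / n ^ s` as a function of a real variable. -/
noncomputable def polyLog (s : ℕ) (x : ℝ) : ℝ :=
  ∑' n : ℕ, x ^ (n + 1) / ((n : ℝ) + 1) ^ s

/-- The second-order harmonic numbers, indexed from `H_1`. -/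
noncomputable def harmonicTwo (n : ℕ) : ℝ :=
  ∑ j ∈ Finset.Icc 1 (n + 1), (1 : ℝ) / (j : ℝ) ^ 2

/-- An antiderivative of `c * log y ^ 2 / (1 - c * y)`. -/
noncomputable def logSqPrimitive (c y : ℝ) : ℝ :=
  -(Real.log y ^ 2 * Real.log (1 - c * y)) - 2 * (Real.log y * polyLog 2 (c * y))
    + 2 * polyLog 3 (c * y)

/-- An antiderivative of `log (1 + u) ^ 2 / u`. -/
noncomputable def logOneAddSqPrimitive (u : ℝ) : ℝ :=
  Real.log (1 + u) ^ 3 / 3 - logSqPrimitive 1 (1 / (1 + u))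

lemma summable_succ_mul_pow {r : ℝ} (h0 : 0 ≤ r) (h1 : r < 1) :
    Summable (fun n : ℕ => ((n : ℝ) + 1) * r ^ n) := by
  have hr : ‖r‖ < 1 := by rwa [Real.norm_of_nonneg h0]
  have h := (summable_pow_mul_geometric_of_norm_lt_one 1 hr).add
    (summable_geometric_of_norm_lt_one hr)
  refine h.congr fun n => ?_
  ring

lemma summable_mul_pow {a : ℕ → ℝ} (ha : ∀ n, |a n| ≤ (n : ℝ) + 1) {x : ℝ} (hx : |x| < 1) :
    Summable (fun n => a n * x ^ n) := by
  refine Summable.of_norm_bounded (summable_succ_mul_pow (abs_nonneg x) hx) fun n => ?_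
  rw [Real.norm_eq_abs, abs_mul, abs_pow]
  gcongr
  exact ha n

lemma summable_mul_pow_succ_div {a : ℕ → ℝ} (ha : ∀ n, |a n| ≤ (n : ℝ) + 1) {x : ℝ}
    (hx : |x| < 1) : Summable (fun n : ℕ => a n * x ^ (n + 1) / ((n : ℝ) + 1)) := by
  refine Summable.of_norm_bounded (summable_geometric_of_lt_one (abs_nonneg x) hx) fun n => ?_
  have hn : (0 : ℝ) < (n : ℝ) + 1 := by positivity
  rw [Real.norm_eq_abs, abs_div, abs_mul, abs_pow, abs_of_pos hn, div_le_iff₀ hn, pow_succ]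
  calc |a n| * (|x| ^ n * |x|) ≤ ((n : ℝ) + 1) * (|x| ^ n * 1) := by
        gcongr
        exact ha n
    _ = _ := by ring

lemma hasDerivAt_tsum_mul_pow_succ_div {a : ℕ → ℝ} (ha : ∀ n, |a n| ≤ (n : ℝ) + 1) {x : ℝ}
    (hx : |x| < 1) :
    HasDerivAt (fun x => ∑' n : ℕ, a n * x ^ (n + 1) / ((n : ℝ) + 1)) (∑' n, a n * x ^ n) x := by
  obtain ⟨r, hxr, hr⟩ := exists_between hx
  have h0 : 0 ≤ r := (abs_nonneg x).trans hxr.le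
  refine hasDerivAt_tsum_of_isPreconnected
    (g := fun n x => a n * x ^ (n + 1) / ((n : ℝ) + 1)) (g' := fun n x => a n * x ^ n)
    (t := Metric.ball (0 : ℝ) r) (y₀ := 0)
    (summable_succ_mul_pow h0 hr) Metric.isOpen_ball (convex_ball (0 : ℝ) r).isPreconnected
    (fun n y _ => ?_) (fun n y hy => ?_) ?_ ?_ ?_
  · have hn : (n : ℝ) + 1 ≠ 0 := by positivity
    refine (((hasDerivAt_pow (n + 1) y).const_mul (a n)).div_const ((n : ℝ) + 1)).congr_deriv ?_
    rw [Nat.cast_add_one, Nat.add_sub_cancel]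
    field_simp
  · have hy' : |y| ≤ r := by simpa using (mem_ball_zero_iff.1 hy).le
    rw [Real.norm_eq_abs, abs_mul, abs_pow]
    gcongr
    exact ha n
  · exact Metric.mem_ball_self ((abs_nonneg x).trans_lt hxr)
  · exact summable_mul_pow_succ_div ha (by simp)
  · simpa using hxr

lemma polyLog_zero_right (s : ℕ) : polyLog s 0 = 0 := by simp [polyLog]

lemma polyLog_one_left {x : ℝ} (hx : |x| < 1) : polyLog 1 x = -Real.log (1 - x) := by
  simpa [polyLog] using (Real.hasSum_pow_div_log_of_abs_lt_one hx).tsum_eq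

lemma hasDerivAt_polyLog_succ (s : ℕ) {x : ℝ} (hx : |x| < 1) :
    HasDerivAt (polyLog (s + 1)) (∑' n : ℕ, 1 / ((n : ℝ) + 1) ^ s * x ^ n) x := by
  have h := hasDerivAt_tsum_mul_pow_succ_div (a := fun n => 1 / ((n : ℝ) + 1) ^ s)
    (fun n => ?_) hx
  · convert h using 1
    funext y
    refine tsum_congr fun n => ?_
    rw [one_div_mul_eq_div, div_div, pow_succ ((n : ℝ) + 1) s]
  · have h1 : (1 : ℝ) ≤ ((n : ℝ) + 1) ^ s := one_le_pow₀ (by simp)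
    rw [abs_of_pos (by positivity)]
    calc 1 / ((n : ℝ) + 1) ^ s ≤ 1 := by
          rw [div_le_one (by positivity)]
          exact h1
      _ ≤ _ := by simp

lemma mul_tsum_eq_polyLog (s : ℕ) (x : ℝ) :
    x * ∑' n : ℕ, 1 / ((n : ℝ) + 1) ^ s * x ^ n = polyLog s x := by
  rw [← tsum_mul_left, polyLog]
  refine tsum_congr fun n => ?_
  ring

lemma hasDerivAt_polyLog_succ_of_ne_zero (s : ℕ) {x : ℝ} (hx : |x| < 1) (h0 : x ≠ 0) :
    HasDerivAt (polyLog (s + 1)) (polyLog s x / x) x := by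
  rw [← mul_tsum_eq_polyLog, mul_div_cancel_left₀ _ h0]
  exact hasDerivAt_polyLog_succ s hx

lemma hasDerivAt_polyLog_two {x : ℝ} (hx : |x| < 1) (h0 : x ≠ 0) :
    HasDerivAt (polyLog 2) (-Real.log (1 - x) / x) x := by
  rw [← polyLog_one_left hx]
  exact hasDerivAt_polyLog_succ_of_ne_zero 1 hx h0

lemma summable_one_div_succ_pow {s : ℕ} (hs : 2 ≤ s) :
    Summable (fun n : ℕ => 1 / ((n : ℝ) + 1) ^ s) := by
  have h := (summable_nat_add_iff 1).2 (Real.summable_one_div_nat_pow.2 (show 1 < s by omega))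
  simpa using h

lemma norm_polyLog_term_le (s n : ℕ) {x : ℝ} (hx : |x| ≤ 1) :
    ‖x ^ (n + 1) / ((n : ℝ) + 1) ^ s‖ ≤ 1 / ((n : ℝ) + 1) ^ s := by
  have hn : (0 : ℝ) < ((n : ℝ) + 1) ^ s := by positivity
  rw [Real.norm_eq_abs, abs_div, abs_pow, abs_of_pos hn]
  gcongr
  exact pow_le_one₀ (abs_nonneg x) hx

lemma continuousOn_polyLog {s : ℕ} (hs : 2 ≤ s) : ContinuousOn (polyLog s) (Icc (-1) 1) :=
  continuousOn_tsum (fun n => by fun_prop) (summable_one_div_succ_pow hs)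
    fun n _ hx => norm_polyLog_term_le s n (abs_le.2 hx)

lemma polyLog_add_polyLog_neg {s : ℕ} (hs : 2 ≤ s) {x : ℝ} (hx : |x| ≤ 1) :
    polyLog s x + polyLog s (-x) = 2 / 2 ^ s * polyLog s (x ^ 2) := by
  have hsum : ∀ y : ℝ, |y| ≤ 1 → Summable fun n : ℕ => y ^ (n + 1) / ((n : ℝ) + 1) ^ s :=
    fun y hy => Summable.of_norm_bounded (summable_one_div_succ_pow hs)
      fun n => norm_polyLog_term_le s n hy
  set g : ℕ → ℝ := fun n => x ^ (n + 1) / ((n : ℝ) + 1) ^ s + (-x) ^ (n + 1) / ((n : ℝ) + 1) ^ s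
    with hg
  have h : Summable g := (hsum x hx).add (hsum (-x) (by rwa [abs_neg]))
  have hsplit : ∑' k, g (2 * k) + ∑' k, g (2 * k + 1) = ∑' n, g n :=
    tsum_even_add_odd (h.comp_injective fun a b hab => by simpa using hab)
      (h.comp_injective fun a b hab => by simpa using hab)
  rw [polyLog, polyLog, ← (hsum x hx).tsum_add (hsum (-x) (by rwa [abs_neg])), ← hsplit,
    polyLog, ← tsum_mul_left]
  have heven : ∀ k : ℕ, g (2 * k) = 0 := fun k => by
    rw [hg]
    dsimp only
    rw [Odd.neg_pow ⟨k, rfl⟩]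
    ring
  simp only [heven, tsum_zero, zero_add]
  refine tsum_congr fun k => ?_
  have hk : (k : ℝ) + 1 ≠ 0 := by positivity
  rw [hg]
  dsimp only
  rw [Even.neg_pow ⟨k + 1, by ring⟩, ← pow_mul,
    show (((2 * k + 1 : ℕ) : ℝ) + 1) = 2 * ((k : ℝ) + 1) by push_cast; ring, mul_pow,
    show 2 * k + 1 + 1 = 2 * (k + 1) by ring]
  field_simp
  ring

lemma polyLog_three_neg_one : polyLog 3 (-1) = -(3 / 4) * polyLog 3 1 := by
  have h := polyLog_add_polyLog_neg (s := 3) (by norm_num) (x := 1) (by simp)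
  norm_num at h
  linarith

lemma eq_of_hasDerivAt_zero {f : ℝ → ℝ} {a b : ℝ} (hab : a < b)
    (hc : ContinuousOn f (Icc a b)) (hd : ∀ x ∈ Ioo a b, HasDerivAt f 0 x) : f b = f a := by
  obtain ⟨c, _, h⟩ := exists_hasDerivAt_eq_slope f (fun _ => 0) hab hc hd
  have := (sub_pos.2 hab).ne'
  field_simp at h
  linarith

lemma continuous_abs_mul_log_sq : Continuous fun y : ℝ => |y| * Real.log y ^ 2 := by
  have h : Continuous fun y : ℝ => (2 * (√|y| * Real.log √|y|)) ^ 2 :=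
    (continuous_const.mul (Real.continuous_mul_log.comp
      (Real.continuous_sqrt.comp continuous_abs))).pow 2
  refine h.congr fun y => ?_
  rw [Real.log_sqrt (abs_nonneg y), Real.log_abs, mul_pow, mul_pow, Real.sq_sqrt (abs_nonneg y)]
  ring

lemma continuousAt_log_mul {f : ℝ → ℝ} (hf : DifferentiableAt ℝ f 0) (h0 : f 0 = 0) :
    ContinuousAt (fun y => Real.log y * f y) 0 := by
  have h := Real.continuous_mul_log.continuousAt.mul (continuousAt_dslope_same.2 hf)
  refine h.congr (Eventually.of_forall fun y => ?_)
  have hy := sub_smul_dslope f 0 y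
  simp only [sub_zero, smul_eq_mul, h0] at hy
  simp only [Pi.mul_apply, ← hy]
  ring

lemma continuousAt_log_sq_mul {f : ℝ → ℝ} (hf : DifferentiableAt ℝ f 0) (h0 : f 0 = 0) :
    ContinuousAt (fun y => Real.log y ^ 2 * f y) 0 := by
  have h : ContinuousAt (fun y => y * Real.log y ^ 2) 0 := by
    rw [Metric.continuousAt_iff]
    have := Metric.continuousAt_iff.1 (continuous_abs_mul_log_sq.continuousAt (x := 0))
    simpa [Real.dist_eq, abs_mul] using this
  have h := h.mul (continuousAt_dslope_same.2 hf)
  refine h.congr (Eventually.of_forall fun y => ?_)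
  have hy := sub_smul_dslope f 0 y
  simp only [sub_zero, smul_eq_mul, h0] at hy
  simp only [Pi.mul_apply, ← hy]
  ring

lemma differentiableAt_polyLog_succ_mul (s : ℕ) (c : ℝ) :
    DifferentiableAt ℝ (fun y => polyLog (s + 1) (c * y)) 0 := by
  have h : DifferentiableAt ℝ (polyLog (s + 1)) (c * 0) :=
    (hasDerivAt_polyLog_succ s (by simp)).differentiableAt
  exact h.comp 0 (by fun_prop)

lemma hasDerivAt_logSqPrimitive {c y : ℝ} (hc : |c| = 1) (hy : y ∈ Ioo (0 : ℝ) 1) :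
    HasDerivAt (logSqPrimitive c) (c * Real.log y ^ 2 / (1 - c * y)) y := by
  have hy0 : y ≠ 0 := hy.1.ne'
  have hc0 : c ≠ 0 := by
    rintro rfl
    simp at hc
  have hcy : |c * y| < 1 := by
    rw [abs_mul, hc, one_mul, abs_of_pos hy.1]
    exact hy.2
  have hcy0 : c * y ≠ 0 := mul_ne_zero hc0 hy0
  have h1 : 1 - c * y ≠ 0 := ne_of_gt (by linarith [(abs_lt.1 hcy).2])
  have hl := Real.hasDerivAt_log hy0
  have hm : HasDerivAt (fun y => c * y) c y := by simpa using (hasDerivAt_id y).const_mul c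
  have h2 := (hasDerivAt_polyLog_two hcy hcy0).comp y hm
  have h3 := (hasDerivAt_polyLog_succ_of_ne_zero 2 hcy hcy0).comp y hm
  have hlc := (hm.const_sub 1).log h1
  have h := (((hl.pow 2).mul hlc).neg.sub ((hl.mul h2).const_mul 2)).add (h3.const_mul 2)
  refine h.congr_deriv ?_
  simp only [Function.comp, Pi.pow_apply]
  field_simp
  ring

lemma continuousAt_log_mul_log_one_sub_one :
    ContinuousAt (fun y => Real.log y * Real.log (1 - y)) 1 := by
  have h : ContinuousAt (fun y => Real.log y * Real.log (1 - y)) (1 - 1) := by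
    rw [sub_self]
    refine continuousAt_log_mul ?_ (by simp)
    exact DifferentiableAt.log (by fun_prop) (by simp)
  have h2 := ContinuousAt.comp (f := fun y : ℝ => 1 - y) h (by fun_prop)
  refine h2.congr (Eventually.of_forall fun y => ?_)
  simp [mul_comm]

lemma continuousOn_logSqPrimitive {c : ℝ} (hc : |c| = 1) :
    ContinuousOn (logSqPrimitive c) (Icc 0 1) := by
  intro y hy
  rcases hy.1.eq_or_lt with rfl | h0
  · refine ContinuousAt.continuousWithinAt ?_
    refine ((continuousAt_log_sq_mul ?_ (by simp)).neg.sub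
      (continuousAt_const.mul (continuousAt_log_mul ?_ ?_))).add
      (continuousAt_const.mul (differentiableAt_polyLog_succ_mul 2 c).continuousAt)
    · exact DifferentiableAt.log (by fun_prop) (by simp)
    · exact differentiableAt_polyLog_succ_mul 1 c
    · simp [polyLog_zero_right]
  rcases hy.2.eq_or_lt with rfl | h1
  · have hmaps : MapsTo (fun y : ℝ => c * y) (Icc 0 1) (Icc (-1) 1) := fun z hz => by
      rw [mem_Icc, ← abs_le, abs_mul, hc, one_mul, abs_of_nonneg hz.1]
      exact hz.2
    have hpoly : ∀ s : ℕ, 2 ≤ s →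
        ContinuousWithinAt (fun y => polyLog s (c * y)) (Icc 0 1) 1 := fun s hs =>
      ((continuousOn_polyLog hs).comp (by fun_prop) hmaps) 1 hy
    have hlog : ContinuousAt Real.log 1 := Real.continuousAt_log one_ne_zero
    have hprod : ContinuousAt (fun y => Real.log y * Real.log (1 - c * y)) 1 := by
      rcases eq_or_eq_neg_of_abs_eq hc with rfl | rfl
      · simpa using continuousAt_log_mul_log_one_sub_one
      · exact hlog.mul (ContinuousAt.log (by fun_prop) (by norm_num))
    have hfirst : ContinuousAt (fun y => Real.log y ^ 2 * Real.log (1 - c * y)) 1 :=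
      (hlog.mul hprod).congr (Eventually.of_forall fun y => by simp only [Pi.mul_apply]; ring)
    exact (hfirst.continuousWithinAt.neg.sub (continuousWithinAt_const.mul
      (hlog.continuousWithinAt.mul (hpoly 2 le_rfl)))).add
      (continuousWithinAt_const.mul (hpoly 3 (by norm_num)))
  · exact (hasDerivAt_logSqPrimitive hc ⟨h0, h1⟩).continuousAt.continuousWithinAt

lemma logSqPrimitive_zero (c : ℝ) : logSqPrimitive c 0 = 0 := by
  simp [logSqPrimitive, polyLog_zero_right]

lemma logSqPrimitive_one (c : ℝ) : logSqPrimitive c 1 = 2 * polyLog 3 c := by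
  simp [logSqPrimitive]

lemma hasDerivAt_div_one_add {u : ℝ} (hu : 0 ≤ u) :
    HasDerivAt (fun u : ℝ => u / (1 + u)) (1 / (1 + u) ^ 2) u := by
  have h1 : 1 + u ≠ 0 := by positivity
  refine ((hasDerivAt_id u).div ((hasDerivAt_id u).const_add 1) h1).congr_deriv ?_
  simp

lemma hasDerivAt_log_one_add {u : ℝ} (hu : 0 ≤ u) :
    HasDerivAt (fun u : ℝ => Real.log (1 + u)) (1 / (1 + u)) u :=
  ((hasDerivAt_id u).const_add 1).log (by simp only [id]; positivity)

lemma abs_div_one_add_lt_one {u : ℝ} (hu : 0 ≤ u) : |u / (1 + u)| < 1 := by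
  rw [abs_of_nonneg (by positivity), div_lt_one (by positivity)]
  linarith

/-- Landen's identity for the dilogarithm. -/
lemma polyLog_two_div_one_add {u : ℝ} (h0 : 0 < u) (h1 : u < 1) :
    polyLog 2 (u / (1 + u)) = -polyLog 2 (-u) - Real.log (1 + u) ^ 2 / 2 := by
  have hderiv2 : ∀ v : ℝ, |v| < 1 → DifferentiableAt ℝ (polyLog 2) v := fun v hv =>
    (hasDerivAt_polyLog_succ 1 hv).differentiableAt
  have h := eq_of_hasDerivAt_zero (a := 0) (b := u)
    (f := fun v => polyLog 2 (v / (1 + v)) + polyLog 2 (-v) + Real.log (1 + v) ^ 2 / 2) h0 ?_ ?_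
  · simp [polyLog_zero_right] at h
    linarith
  · intro v hv
    refine ContinuousAt.continuousWithinAt ?_
    have ha := ContinuousAt.comp (f := fun v : ℝ => v / (1 + v))
      (hderiv2 _ (abs_div_one_add_lt_one hv.1)).continuousAt
      (hasDerivAt_div_one_add hv.1).continuousAt
    have hb := ContinuousAt.comp (f := fun v : ℝ => -v)
      (hderiv2 (-v) (by rw [abs_neg, abs_of_nonneg hv.1]; linarith [hv.2])).continuousAt
      continuousAt_neg
    exact (ha.add hb).add (((hasDerivAt_log_one_add hv.1).continuousAt.pow 2).div_const 2)
  · intro v hv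
    have hv0 : v ≠ 0 := hv.1.ne'
    have hv1 : 1 + v ≠ 0 := ne_of_gt (by linarith [hv.1])
    have ha := (hasDerivAt_polyLog_two (abs_div_one_add_lt_one hv.1.le)
      (div_ne_zero hv0 hv1)).comp v (hasDerivAt_div_one_add hv.1.le)
    have hb := (hasDerivAt_polyLog_two (x := -v)
      (by rw [abs_neg, abs_of_pos hv.1]; linarith [hv.2]) (neg_ne_zero.2 hv0)).comp v
      (hasDerivAt_neg v)
    refine ((ha.add hb).add (((hasDerivAt_log_one_add hv.1.le).pow 2).div_const 2)).congr_deriv ?_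
    have hlog : Real.log (1 - v / (1 + v)) = -Real.log (1 + v) := by
      rw [← Real.log_inv]
      congr 1
      field_simp
      ring
    rw [hlog, sub_neg_eq_add]
    field_simp
    ring

lemma hasDerivAt_one_div_one_add {u : ℝ} (hu : 0 ≤ u) :
    HasDerivAt (fun u : ℝ => 1 / (1 + u)) (-1 / (1 + u) ^ 2) u := by
  have h1 : 1 + u ≠ 0 := by positivity
  refine ((hasDerivAt_const u (1 : ℝ)).div ((hasDerivAt_id u).const_add 1) h1).congr_deriv ?_
  simp

lemma hasDerivAt_logOneAddSqPrimitive {u : ℝ} (hu : 0 < u) :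
    HasDerivAt logOneAddSqPrimitive (Real.log (1 + u) ^ 2 / u) u := by
  have h1 : 0 < 1 + u := by positivity
  have hmem : 1 / (1 + u) ∈ Ioo (0 : ℝ) 1 :=
    ⟨by positivity, by rw [div_lt_one h1]; linarith⟩
  have h := (((hasDerivAt_log_one_add hu.le).pow 3).div_const 3).sub
    ((hasDerivAt_logSqPrimitive (c := 1) (by simp) hmem).comp u (hasDerivAt_one_div_one_add hu.le))
  refine h.congr_deriv ?_
  have hsub : 1 - 1 * (1 / (1 + u)) = u / (1 + u) := by
    field_simp
    ring
  rw [hsub, one_div, Real.log_inv]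
  field_simp
  ring

lemma continuousOn_logOneAddSqPrimitive : ContinuousOn logOneAddSqPrimitive (Icc 0 1) := by
  have hmaps : MapsTo (fun u : ℝ => 1 / (1 + u)) (Icc 0 1) (Icc 0 1) := fun u hu => by
    have h1 : 0 < 1 + u := by linarith [hu.1]
    exact ⟨by positivity, by rw [div_le_one h1]; linarith [hu.1]⟩
  have h := (continuousOn_logSqPrimitive (c := 1) (by simp)).comp
    (fun u hu => (hasDerivAt_one_div_one_add hu.1).continuousAt.continuousWithinAt) hmaps
  refine ContinuousOn.sub (fun u hu => ?_) h
  exact (((hasDerivAt_log_one_add hu.1).continuousAt.pow 3).div_const 3).continuousWithinAt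

lemma logOneAddSqPrimitive_zero : logOneAddSqPrimitive 0 = -2 * polyLog 3 1 := by
  simp [logOneAddSqPrimitive, logSqPrimitive_one]

lemma hasDerivAt_one_sub_div_one_add {u : ℝ} (hu : 0 ≤ u) :
    HasDerivAt (fun u : ℝ => (1 - u) / (1 + u)) (-2 / (1 + u) ^ 2) u := by
  have h1 : 1 + u ≠ 0 := by positivity
  refine (((hasDerivAt_id u).const_sub 1).div ((hasDerivAt_id u).const_add 1) h1).congr_deriv ?_
  simp only [id]
  ring

/-- Equivalent to `∫ log (1 + u) ^ 2 / u = ζ(3) / 4` over the unit interval; it comes from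
`(a + b) ^ 2 + (a - b) ^ 2 = 2 * a ^ 2 + 2 * b ^ 2` with `a = log (1 - u)`, `b = log (1 + u)`. -/
lemma logOneAddSqPrimitive_one : logOneAddSqPrimitive 1 = -(7 / 4) * polyLog 3 1 := by
  have hM := continuousOn_logSqPrimitive (c := 1) (by simp)
  have hN := continuousOn_logSqPrimitive (c := -1) (by simp)
  have h := eq_of_hasDerivAt_zero (a := 0) (b := 1)
    (f := fun u => -(1 / 2) * logSqPrimitive 1 (1 - u ^ 2)
      - (logSqPrimitive 1 ((1 - u) / (1 + u)) - logSqPrimitive (-1) ((1 - u) / (1 + u)))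
      + 2 * logSqPrimitive 1 (1 - u) - 2 * logOneAddSqPrimitive u) one_pos ?_ ?_
  · norm_num [logSqPrimitive_zero, logSqPrimitive_one, logOneAddSqPrimitive_zero,
      polyLog_three_neg_one] at h
    linarith
  · have hsq : MapsTo (fun u : ℝ => 1 - u ^ 2) (Icc 0 1) (Icc 0 1) := fun u hu =>
      ⟨by nlinarith [hu.1, hu.2], by nlinarith [hu.1, hu.2]⟩
    have hsub : MapsTo (fun u : ℝ => 1 - u) (Icc 0 1) (Icc 0 1) := fun u hu =>
      ⟨by linarith [hu.2], by linarith [hu.1]⟩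
    have hdiv : MapsTo (fun u : ℝ => (1 - u) / (1 + u)) (Icc 0 1) (Icc 0 1) := fun u hu => by
      have h1 : 0 < 1 + u := by linarith [hu.1]
      exact ⟨div_nonneg (by linarith [hu.2]) h1.le, by rw [div_le_one h1]; linarith [hu.1]⟩
    have hdivc : ContinuousOn (fun u : ℝ => (1 - u) / (1 + u)) (Icc 0 1) := fun u hu =>
      (hasDerivAt_one_sub_div_one_add hu.1).continuousAt.continuousWithinAt
    exact (((continuousOn_const.mul (hM.comp (by fun_prop) hsq)).sub
      ((hM.comp hdivc hdiv).sub (hN.comp hdivc hdiv))).add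
      (continuousOn_const.mul (hM.comp (by fun_prop) hsub))).sub
      (continuousOn_const.mul continuousOn_logOneAddSqPrimitive)
  · intro u hu
    obtain ⟨h0, h1⟩ := hu
    have hp : 0 < 1 + u := by linarith
    have hm : 0 < 1 - u := by linarith
    have hsq : 1 - u ^ 2 ∈ Ioo (0 : ℝ) 1 := ⟨by nlinarith, by nlinarith⟩
    have hsub : 1 - u ∈ Ioo (0 : ℝ) 1 := ⟨hm, by linarith⟩
    have hdiv : (1 - u) / (1 + u) ∈ Ioo (0 : ℝ) 1 :=
      ⟨div_pos hm hp, by rw [div_lt_one hp]; linarith⟩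
    have hy := hasDerivAt_one_sub_div_one_add h0.le
    have d1 := (hasDerivAt_logSqPrimitive (c := 1) (by simp) hsq).comp u
      ((hasDerivAt_pow 2 u).const_sub 1)
    have d2 := (hasDerivAt_logSqPrimitive (c := 1) (by simp) hdiv).comp u hy
    have d3 := (hasDerivAt_logSqPrimitive (c := -1) (by simp) hdiv).comp u hy
    have d4 := (hasDerivAt_logSqPrimitive (c := 1) (by simp) hsub).comp u
      ((hasDerivAt_id u).const_sub 1)
    have d5 := hasDerivAt_logOneAddSqPrimitive h0
    refine ((((d1.const_mul (-(1 / 2))).sub (d2.sub d3)).add (d4.const_mul 2)).sub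
      (d5.const_mul 2)).congr_deriv ?_
    have e1 : Real.log (1 - u ^ 2) = Real.log (1 - u) + Real.log (1 + u) := by
      rw [← Real.log_mul hm.ne' hp.ne']
      congr 1
      ring
    have e2 : Real.log ((1 - u) / (1 + u)) = Real.log (1 - u) - Real.log (1 + u) :=
      Real.log_div hm.ne' hp.ne'
    have e3 : 1 - 1 * ((1 - u) / (1 + u)) = 2 * u / (1 + u) := by
      field_simp
      ring
    have e4 : 1 - -1 * ((1 - u) / (1 + u)) = 2 / (1 + u) := by
      field_simp
      ring
    have e5 : 1 - 1 * (1 - u ^ 2) = u ^ 2 := by ring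
    have e6 : 1 - 1 * (1 - u) = u := by ring
    rw [e1, e2, e3, e4, e5, e6]
    field_simp
    ring

lemma harmonicTwo_succ (n : ℕ) :
    harmonicTwo (n + 1) = harmonicTwo n + 1 / ((n : ℝ) + 2) ^ 2 := by
  rw [harmonicTwo, Finset.sum_Icc_succ_top (by omega), harmonicTwo]
  push_cast
  ring

lemma abs_harmonicTwo_le (n : ℕ) : |harmonicTwo n| ≤ (n : ℝ) + 1 := by
  rw [abs_of_nonneg (Finset.sum_nonneg fun j _ => by positivity)]
  induction n with
  | zero => simp [harmonicTwo]
  | succ n ih =>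
    have h : 1 / ((n : ℝ) + 2) ^ 2 ≤ 1 := by
      rw [div_le_one (by positivity)]
      exact one_le_pow₀ (by linarith [(Nat.cast_nonneg n : (0 : ℝ) ≤ n)])
    rw [harmonicTwo_succ]
    push_cast
    linarith

lemma tsum_harmonicTwo_mul_pow {x : ℝ} (hx : |x| < 1) (h0 : x ≠ 0) :
    ∑' n, harmonicTwo n * x ^ n = polyLog 2 x / (x * (1 - x)) := by
  have hs := summable_mul_pow abs_harmonicTwo_le hx
  have hd : Summable fun n : ℕ => 1 / ((n : ℝ) + 1) ^ 2 * x ^ n := by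
    refine summable_mul_pow (fun n => ?_) hx
    rw [abs_of_pos (by positivity), div_le_iff₀ (by positivity)]
    have : (1 : ℝ) ≤ ((n : ℝ) + 1) ^ 3 := one_le_pow₀ (by simp)
    linarith [pow_succ' ((n : ℝ) + 1) 2]
  have hx1 : 1 - x ≠ 0 := (sub_pos.2 (abs_lt.1 hx).2).ne'
  have key : (1 - x) * ∑' n, harmonicTwo n * x ^ n = ∑' n : ℕ, 1 / ((n : ℝ) + 1) ^ 2 * x ^ n := by
    have h1 := hs.tsum_eq_zero_add
    have h2 := hd.tsum_eq_zero_add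
    have h3 : ∑' n, harmonicTwo (n + 1) * x ^ (n + 1)
        = x * ∑' n, harmonicTwo n * x ^ n
          + ∑' n : ℕ, 1 / (((n + 1 : ℕ) : ℝ) + 1) ^ 2 * x ^ (n + 1) := by
      rw [← tsum_mul_left, ← (hs.mul_left x).tsum_add ((summable_nat_add_iff 1).2 hd)]
      refine tsum_congr fun n => ?_
      rw [harmonicTwo_succ]
      push_cast
      ring
    have h4 : harmonicTwo 0 = 1 := by simp [harmonicTwo]
    rw [h4] at h1
    norm_num only [Nat.cast_zero, pow_zero, zero_add, one_pow, div_one, mul_one] at h1 h2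
    linarith
  rw [← mul_tsum_eq_polyLog, ← key]
  field_simp

/-- The generating function of `H_n / n` at `1 / 2`, by Landen's identity along `u / (1 + u)`. -/
lemma tsum_harmonicTwo_half :
    ∑' n : ℕ, harmonicTwo n * (1 / 2) ^ (n + 1) / ((n : ℝ) + 1) = 5 / 8 * polyLog 3 1 := by
  set F : ℝ → ℝ := fun x => ∑' n : ℕ, harmonicTwo n * x ^ (n + 1) / ((n : ℝ) + 1) with hF
  have hF0 : F 0 = 0 := by simp [hF]
  have hFd : ∀ x : ℝ, |x| < 1 → HasDerivAt F (∑' n, harmonicTwo n * x ^ n) x := fun x hx =>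
    hasDerivAt_tsum_mul_pow_succ_div abs_harmonicTwo_le hx
  have h := eq_of_hasDerivAt_zero (a := 0) (b := 1)
    (f := fun u => F (u / (1 + u)) + polyLog 3 (-u) + logOneAddSqPrimitive u / 2) one_pos ?_ ?_
  · norm_num [hF0, polyLog_zero_right, polyLog_three_neg_one, logOneAddSqPrimitive_zero,
      logOneAddSqPrimitive_one] at h
    change F (1 / 2) = _
    linarith
  · have hneg : MapsTo (fun u : ℝ => -u) (Icc 0 1) (Icc (-1) 1) := fun u hu =>
      ⟨by linarith [hu.2], by linarith [hu.1]⟩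
    refine ContinuousOn.add (ContinuousOn.add (fun u hu => ?_)
      ((continuousOn_polyLog (by norm_num)).comp (by fun_prop) hneg))
      (continuousOn_logOneAddSqPrimitive.div_const 2)
    exact (ContinuousAt.comp (f := fun u : ℝ => u / (1 + u))
      (hFd _ (abs_div_one_add_lt_one hu.1)).continuousAt
      (hasDerivAt_div_one_add hu.1).continuousAt).continuousWithinAt
  · intro u hu
    have hu0 : u ≠ 0 := hu.1.ne'
    have hu1 : 1 + u ≠ 0 := ne_of_gt (by linarith [hu.1])
    have hlt := abs_div_one_add_lt_one hu.1.le
    have d1 := (hFd _ hlt).comp u (hasDerivAt_div_one_add hu.1.le)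
    have d2 := (hasDerivAt_polyLog_succ_of_ne_zero 2 (x := -u)
      (by rw [abs_neg, abs_of_pos hu.1]; exact hu.2) (neg_ne_zero.2 hu0)).comp u (hasDerivAt_neg u)
    refine ((d1.add d2).add ((hasDerivAt_logOneAddSqPrimitive hu.1).div_const 2)).congr_deriv ?_
    have hsub : 1 - u / (1 + u) = 1 / (1 + u) := by
      field_simp
      ring
    rw [tsum_harmonicTwo_mul_pow hlt (div_ne_zero hu0 hu1), hsub,
      polyLog_two_div_one_add hu.1 hu.2]
    field_simp
    ring

theorem harmonic_two_over_n_two_pow :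
    HasSum (fun n : ℕ =>
        (∑ j ∈ Finset.Icc 1 (n + 1), (1 : ℝ) / (j : ℝ) ^ 2)
          / (((n : ℝ) + 1) * 2 ^ (n + 1)))
      ((5 / 8) * ∑' n : ℕ, 1 / ((n : ℝ) + 1) ^ 3) := by
  have hs := summable_mul_pow_succ_div abs_harmonicTwo_le (x := 1 / 2)
    (by rw [abs_of_pos (by norm_num)]; norm_num)
  have h := hs.hasSum
  rw [tsum_harmonicTwo_half] at h
  simp only [polyLog, one_pow] at h
  convert h using 2 with n
  change harmonicTwo n / _ = _
  rw [one_div_pow]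
  field_simp
end

section
/- ∑_{n=1}^{∞} (1/n²) ∑_{k=1}^{n} (-1)^{k+1}/k = (3/2) ζ(2) log 2 - (1/4) ζ(3). -/
open Filter Topology Finset

/-- The general term `1 / (m n (m + n))` of the weight three Tornheim series,
with `m = i + 1` and `n = j + 1`. -/
noncomputable def tornheimTerm (p : ℕ × ℕ) : ℝ :=
  1 / (((p.1 : ℝ) + 1) * ((p.2 : ℝ) + 1) * ((p.1 : ℝ) + p.2 + 2))

theorem tornheimTerm_swap (i j : ℕ) : tornheimTerm (i, j) = tornheimTerm (j, i) := by
  simp only [tornheimTerm]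
  ring

theorem summable_tornheimTerm : Summable tornheimTerm := by
  have h : Summable fun n : ℕ => 1 / ((n : ℝ) + 1) ^ (3 / 2 : ℝ) := by
    have := (summable_nat_add_iff 1).2 (Real.summable_one_div_nat_rpow.2
      (by norm_num : (1 : ℝ) < 3 / 2))
    simpa using this
  refine (h.mul_of_nonneg h (fun n => by positivity) (fun n => by positivity)).of_nonneg_of_le
    (fun p => by unfold tornheimTerm; positivity) fun p => ?_
  have key : ∀ x : ℝ, 0 < x → x ^ (3 / 2 : ℝ) = x * √x := fun x hx => by
    rw [Real.sqrt_eq_rpow, ← Real.rpow_one_add' hx.le (by norm_num)]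
    norm_num
  have hx : (0 : ℝ) < (p.1 : ℝ) + 1 := by positivity
  have hy : (0 : ℝ) < (p.2 : ℝ) + 1 := by positivity
  rw [tornheimTerm, key _ hx, key _ hy, div_mul_div_comm, one_mul]
  refine one_div_le_one_div_of_le (by positivity) ?_
  have h2 : √((p.1 : ℝ) + 1) * √((p.2 : ℝ) + 1) ≤ (p.1 : ℝ) + p.2 + 2 := by
    nlinarith [sq_nonneg (√((p.1 : ℝ) + 1) - √((p.2 : ℝ) + 1)), Real.sq_sqrt hx.le,
      Real.sq_sqrt hy.le]
  calc _ = ((p.1 : ℝ) + 1) * ((p.2 : ℝ) + 1) * (√((p.1 : ℝ) + 1) * √((p.2 : ℝ) + 1)) := by ring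
    _ ≤ _ := by gcongr

theorem hasSum_sub_shift {f : ℕ → ℝ} {K : ℕ} (hf : Tendsto f atTop (𝓝 0))
    (hs : Summable fun j => f j - f (j + K)) :
    HasSum (fun j => f j - f (j + K)) (∑ j ∈ range K, f j) := by
  rw [hs.hasSum_iff_tendsto_nat]
  have h : ∀ n, ∑ j ∈ range n, (f j - f (j + K)) =
      ∑ j ∈ range K, f j - ∑ j ∈ range K, f (n + j) := fun n => by
    have h1 := sum_range_add f n K
    have h2 := sum_range_add f K n
    rw [add_comm K n] at h2
    simp_rw [sum_sub_distrib, add_comm _ K]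
    linarith
  simp_rw [h]
  have h0 : Tendsto (fun n => ∑ j ∈ range K, f (n + j)) atTop (𝓝 (∑ j ∈ range K, 0)) :=
    tendsto_finsetSum _ fun j _ => hf.comp (tendsto_add_atTop_nat j)
  simpa using h0.const_sub (∑ j ∈ range K, f j)

theorem HasSum.sum_range_of_prod {g : ℕ × ℕ → ℝ} {a : ℝ} (h : HasSum g a) :
    HasSum (fun n => ∑ i ∈ range (n + 1), g (i, n - i)) a := by
  have h1 := (HasAntidiagonal.sigmaAntidiagonalEquivProd.hasSum_iff.2 h).sigma
    fun n => hasSum_fintype _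
  convert! h1 using 2 with n
  rw [← Nat.sum_antidiagonal_eq_sum_range_succ_mk, ← sum_coe_sort]
  rfl

theorem sum_range_add_reflect (a : ℕ → ℝ) (n : ℕ) :
    ∑ i ∈ range (n + 1), (a i + a (n - i)) = 2 * ∑ i ∈ range (n + 1), a i := by
  have h := sum_range_reflect a (n + 1)
  simp only [Nat.add_sub_cancel] at h
  rw [sum_add_distrib, h, two_mul]

theorem tendsto_one_div_mul_add_one {c : ℝ} (hc : 0 < c) :
    Tendsto (fun j : ℕ => 1 / (c * (j : ℝ) + 1)) atTop (𝓝 0) := by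
  simp only [one_div]
  exact tendsto_inv_atTop_zero.comp
    (tendsto_atTop_add_const_right _ _ (tendsto_natCast_atTop_atTop.const_mul_atTop hc))

theorem tsum_tornheimTerm : ∑' p, tornheimTerm p = 2 * ∑' n : ℕ, 1 / ((n : ℝ) + 1) ^ 3 := by
  set T := ∑' p, tornheimTerm p
  have hT : HasSum tornheimTerm T := summable_tornheimTerm.hasSum
  have hrow : HasSum (fun i : ℕ => 1 / ((i : ℝ) + 1) ^ 2 * ∑ j ∈ range (i + 1), 1 / ((j : ℝ) + 1))
      T := by
    refine hT.prod_fiberwise fun i => ?_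
    have hi : ((i : ℝ) + 1) ≠ 0 := by positivity
    have he : ∀ j : ℕ, 1 / ((j : ℝ) + 1) - 1 / (((j + (i + 1) : ℕ) : ℝ) + 1) =
        ((i : ℝ) + 1) ^ 2 * tornheimTerm (i, j) := fun j => by
      simp only [tornheimTerm]
      push_cast
      have : (j : ℝ) + (i + 1) + 1 ≠ 0 := by positivity
      have : (i : ℝ) + j + 2 ≠ 0 := by positivity
      field_simp
      ring
    have hs : Summable fun j => tornheimTerm (i, j) := summable_tornheimTerm.prod_factor i
    have h := hasSum_sub_shift (f := fun j : ℕ => 1 / ((j : ℝ) + 1)) (K := i + 1)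
      (by simpa using tendsto_one_div_mul_add_one one_pos)
      ((hs.mul_left (((i : ℝ) + 1) ^ 2)).congr fun j => (he j).symm)
    simp only [he] at h
    convert! h.mul_left (1 / ((i : ℝ) + 1) ^ 2) using 2 with j
    field_simp
  have hdiag : HasSum (fun n : ℕ => 2 * (1 / (((n + 1 : ℕ) : ℝ) + 1) ^ 2 *
      ∑ j ∈ range (n + 1), 1 / ((j : ℝ) + 1))) T := by
    convert! hT.sum_range_of_prod using 2 with n
    rw [mul_left_comm, ← sum_range_add_reflect, mul_sum]
    refine sum_congr rfl fun i hi => ?_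
    obtain ⟨k, rfl⟩ := Nat.exists_eq_add_of_le (Nat.lt_succ_iff.1 (mem_range.1 hi))
    simp only [tornheimTerm, Nat.add_sub_cancel_left]
    push_cast
    have : (i : ℝ) + k + 1 + 1 ≠ 0 := by positivity
    have : (i : ℝ) + k + 2 ≠ 0 := by positivity
    field_simp
    ring
  have hZ : HasSum (fun n : ℕ => 1 / ((n : ℝ) + 1) ^ 3) (∑' n : ℕ, 1 / ((n : ℝ) + 1) ^ 3) := by
    refine Summable.hasSum ?_
    simpa using (summable_nat_add_iff 1).2 (Real.summable_one_div_nat_pow.2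
      (by norm_num : 1 < 3))
  have hU : HasSum (fun i : ℕ => 1 / ((i : ℝ) + 1) ^ 2 * ∑ j ∈ range i, 1 / ((j : ℝ) + 1))
      (T / 2) := by
    rw [← hasSum_nat_add_iff' 1]
    convert! hdiag.div_const 2 using 1
    · ext n; ring
    · simp
  have hTU : T = T / 2 + ∑' n : ℕ, 1 / ((n : ℝ) + 1) ^ 3 := by
    refine hrow.unique ?_
    convert! hU.add hZ using 2 with i
    rw [sum_range_succ]
    have hi : ((i : ℝ) + 1) ≠ 0 := by positivity
    field_simp
  linarith

theorem tsum_tornheimTerm_even_even :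
    ∑' p : ℕ × ℕ, tornheimTerm (2 * p.1, 2 * p.2) =
      2 * ∑' p : ℕ × ℕ, tornheimTerm (2 * p.1 + 1, 2 * p.2) := by
  have hA : Summable fun p : ℕ × ℕ => tornheimTerm (2 * p.1, 2 * p.2) :=
    summable_tornheimTerm.comp_injective (i := fun p : ℕ × ℕ => (2 * p.1, 2 * p.2))
      fun p q h => by simp_all [Prod.ext_iff]
  have hB : Summable fun p : ℕ × ℕ => tornheimTerm (2 * p.1 + 1, 2 * p.2) :=
    summable_tornheimTerm.comp_injective (i := fun p : ℕ × ℕ => (2 * p.1 + 1, 2 * p.2))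
      fun p q h => by simp_all [Prod.ext_iff]
  have hrow := hB.hasSum.prod_fiberwise (g := fun i : ℕ => 1 / (2 * (i : ℝ) + 2) ^ 2 *
      ∑ j ∈ range (i + 1), 1 / (2 * (j : ℝ) + 1)) fun i => by
    have hi : (2 * (i : ℝ) + 2) ≠ 0 := by positivity
    have he : ∀ j : ℕ, 1 / (2 * (j : ℝ) + 1) - 1 / (2 * ((j + (i + 1) : ℕ) : ℝ) + 1) =
        (2 * (i : ℝ) + 2) ^ 2 * tornheimTerm (2 * i + 1, 2 * j) := fun j => by
      simp only [tornheimTerm]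
      push_cast
      have : 2 * ((j : ℝ) + (i + 1)) + 1 ≠ 0 := by positivity
      have : 2 * (i : ℝ) + 1 + 2 * j + 2 ≠ 0 := by positivity
      have : 2 * (i : ℝ) + 1 + 1 ≠ 0 := by positivity
      field_simp
      ring
    have hs : Summable fun j : ℕ => tornheimTerm (2 * i + 1, 2 * j) := hB.prod_factor i
    have h := hasSum_sub_shift (f := fun j : ℕ => 1 / (2 * (j : ℝ) + 1)) (K := i + 1)
      (tendsto_one_div_mul_add_one two_pos)
      ((hs.mul_left ((2 * (i : ℝ) + 2) ^ 2)).congr fun j => (he j).symm)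
    simp only [he] at h
    convert! h.mul_left (1 / (2 * (i : ℝ) + 2) ^ 2) using 2 with j
    field_simp
  refine hA.hasSum.sum_range_of_prod.unique ?_
  convert! hrow.mul_left 2 using 2 with n
  rw [mul_left_comm, ← sum_range_add_reflect, mul_sum]
  refine sum_congr rfl fun i hi => ?_
  obtain ⟨k, rfl⟩ := Nat.exists_eq_add_of_le (Nat.lt_succ_iff.1 (mem_range.1 hi))
  simp only [tornheimTerm, Nat.add_sub_cancel_left]
  push_cast
  have : 2 * ((i : ℝ) + k) + 2 ≠ 0 := by positivity
  have : 2 * (i : ℝ) + 2 * k + 2 ≠ 0 := by positivity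
  field_simp
  ring

theorem tsum_prod_even_odd {F : ℕ × ℕ → ℝ} (hF : Summable F) :
    ∑' p, F p = (∑' p : ℕ × ℕ, F (2 * p.1, 2 * p.2) + ∑' p : ℕ × ℕ, F (2 * p.1, 2 * p.2 + 1)) +
      (∑' p : ℕ × ℕ, F (2 * p.1 + 1, 2 * p.2) + ∑' p : ℕ × ℕ, F (2 * p.1 + 1, 2 * p.2 + 1)) := by
  have he : Function.Injective fun i : ℕ => 2 * i := fun i j h => by simpa using h
  have ho : Function.Injective fun i : ℕ => 2 * i + 1 := fun i j h => by simpa using h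
  have hrow : ∀ r : ℕ → ℕ, Function.Injective r → ∑' i : ℕ, ∑' j : ℕ, F (r i, j) =
      ∑' p : ℕ × ℕ, F (r p.1, 2 * p.2) + ∑' p : ℕ × ℕ, F (r p.1, 2 * p.2 + 1) := by
    intro r hr
    have h0 : Summable fun p : ℕ × ℕ => F (r p.1, 2 * p.2) :=
      hF.comp_injective (hr.prodMap he)
    have h1 : Summable fun p : ℕ × ℕ => F (r p.1, 2 * p.2 + 1) :=
      hF.comp_injective (hr.prodMap ho)
    rw [h0.tsum_prod, h1.tsum_prod, ← h0.prod.tsum_add h1.prod]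
    exact tsum_congr fun i => (tsum_even_add_odd (f := fun j => F (r i, j))
      (h0.prod_factor i) (h1.prod_factor i)).symm
  rw [hF.tsum_prod, ← hrow _ he, ← hrow _ ho]
  exact (tsum_even_add_odd (f := fun i => ∑' j : ℕ, F (i, j))
    (hF.prod.comp_injective he) (hF.prod.comp_injective ho)).symm

theorem summable_alternating_tornheimTerm :
    Summable fun p : ℕ × ℕ => (-1 : ℝ) ^ (p.1 + p.2) * tornheimTerm p :=
  summable_tornheimTerm.of_norm_bounded fun p => by
    have : 0 ≤ tornheimTerm p := by unfold tornheimTerm; positivity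
    simp [abs_of_nonneg this]

theorem tsum_alternating_tornheimTerm :
    ∑' p : ℕ × ℕ, (-1 : ℝ) ^ (p.1 + p.2) * tornheimTerm p =
      (1 / 4) * ∑' n : ℕ, 1 / ((n : ℝ) + 1) ^ 3 := by
  have hodd : ∑' p : ℕ × ℕ, tornheimTerm (2 * p.1 + 1, 2 * p.2 + 1) =
      (1 / 8) * ∑' p, tornheimTerm p := by
    rw [← tsum_mul_left]
    refine tsum_congr fun p => ?_
    simp only [tornheimTerm]
    push_cast
    have : 2 * (p.1 : ℝ) + 1 + 1 ≠ 0 := by positivity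
    have : 2 * (p.2 : ℝ) + 1 + 1 ≠ 0 := by positivity
    have : 2 * (p.1 : ℝ) + 1 + (2 * p.2 + 1) + 2 ≠ 0 := by positivity
    field_simp
    ring
  have hswap : ∑' p : ℕ × ℕ, tornheimTerm (2 * p.1, 2 * p.2 + 1) =
      ∑' p : ℕ × ℕ, tornheimTerm (2 * p.1 + 1, 2 * p.2) := by
    rw [← (Equiv.prodComm ℕ ℕ).tsum_eq]
    exact tsum_congr fun p => tornheimTerm_swap _ _
  have h := tsum_prod_even_odd summable_alternating_tornheimTerm
  have sign_even_even : ∀ p : ℕ × ℕ, (-1 : ℝ) ^ (2 * p.1 + 2 * p.2) = 1 := fun p => by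
    simp [pow_add, pow_mul]
  have sign_even_odd : ∀ p : ℕ × ℕ, (-1 : ℝ) ^ (2 * p.1 + (2 * p.2 + 1)) = -1 := fun p => by
    simp [pow_add, pow_mul]
  have sign_odd_even : ∀ p : ℕ × ℕ, (-1 : ℝ) ^ (2 * p.1 + 1 + 2 * p.2) = -1 := fun p => by
    simp [pow_add, pow_mul]
  have sign_odd_odd : ∀ p : ℕ × ℕ, (-1 : ℝ) ^ (2 * p.1 + 1 + (2 * p.2 + 1)) = 1 := fun p => by
    simp [pow_add, pow_mul]
  simp only [sign_even_even, sign_even_odd, sign_odd_even, sign_odd_odd, one_mul,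
    neg_one_mul, tsum_neg] at h
  rw [h, tsum_tornheimTerm_even_even, hswap, hodd, tsum_tornheimTerm]
  ring

theorem tendsto_sum_alternating_harmonic :
    Tendsto (fun n => ∑ j ∈ range n, (-1 : ℝ) ^ j / ((j : ℝ) + 1)) atTop (𝓝 (Real.log 2)) := by
  obtain ⟨l, hl⟩ : ∃ l, Tendsto (fun n => ∑ j ∈ range n, (-1 : ℝ) ^ j / ((j : ℝ) + 1)) atTop
      (𝓝 l) := by
    simp_rw [div_eq_mul_one_div ((-1 : ℝ) ^ _)]
    refine Antitone.tendsto_alternating_series_of_tendsto_zero (fun i j hij => ?_)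
      (by simpa using tendsto_one_div_mul_add_one one_pos)
    have : (i : ℝ) ≤ j := by exact_mod_cast hij
    exact one_div_le_one_div_of_le (by positivity) (by linarith)
  have abel := Real.tendsto_tsum_powerSeries_nhdsWithin_lt hl
  have hlog : Tendsto (fun x : ℝ => Real.log (1 + x) / x) (𝓝[<] 1) (𝓝 (Real.log (1 + 1) / 1)) := by
    refine Tendsto.mono_left (ContinuousAt.tendsto ?_) nhdsWithin_le_nhds
    fun_prop (disch := norm_num)
  have heq : (fun x : ℝ => ∑' n : ℕ, (-1 : ℝ) ^ n / ((n : ℝ) + 1) * x ^ n) =ᶠ[𝓝[<] 1]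
      fun x => Real.log (1 + x) / x := by
    filter_upwards [Ioo_mem_nhdsLT (zero_lt_one (α := ℝ))] with x hx
    have h := Real.hasSum_pow_div_log_of_abs_lt_one (x := -x)
      (by rw [abs_neg, abs_of_pos hx.1]; exact hx.2)
    rw [sub_neg_eq_add] at h
    have h' := h.mul_left (-1 / x)
    have hx0 := hx.1.ne'
    refine HasSum.tsum_eq ?_
    convert! h' using 1
    · ext n
      rw [neg_pow x, pow_succ, pow_succ]
      field_simp
    · field_simp
  have := tendsto_nhds_unique (abel.congr' heq) hlog
  norm_num at this
  rwa [← this]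

theorem hasSum_one_div_add_one_sq :
    HasSum (fun n : ℕ => 1 / ((n : ℝ) + 1) ^ 2) (Real.pi ^ 2 / 6) := by
  simpa using (hasSum_nat_add_iff' 1).2 hasSum_zeta_two

theorem hasSum_alternating_one_div_add_one_sq :
    HasSum (fun n : ℕ => (-1 : ℝ) ^ n / ((n : ℝ) + 1) ^ 2) (Real.pi ^ 2 / 12) := by
  have hZ := hasSum_one_div_add_one_sq
  have hodd : HasSum (fun n : ℕ => 1 / (((2 * n + 1 : ℕ) : ℝ) + 1) ^ 2) (Real.pi ^ 2 / 24) := by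
    convert! hZ.mul_left (1 / 4) using 1
    · ext n
      push_cast
      have : 2 * (n : ℝ) + 1 + 1 ≠ 0 := by positivity
      field_simp
      ring
    · ring
  have heven : Summable fun n : ℕ => 1 / (((2 * n : ℕ) : ℝ) + 1) ^ 2 :=
    hZ.summable.comp_injective (i := fun n : ℕ => 2 * n) fun i j hij => by simp_all
  have h := (HasSum.even_add_odd (f := fun n : ℕ => 1 / ((n : ℝ) + 1) ^ 2)
    heven.hasSum hodd).unique hZ
  have halt := HasSum.even_add_odd (f := fun n : ℕ => (-1 : ℝ) ^ n / ((n : ℝ) + 1) ^ 2)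
    (m := ∑' n : ℕ, 1 / (((2 * n : ℕ) : ℝ) + 1) ^ 2) (m' := -(Real.pi ^ 2 / 24))
    (by simpa only [pow_mul, neg_one_sq, one_pow] using heven.hasSum)
    (by simpa only [pow_add, pow_mul, neg_one_sq, one_pow, pow_one, one_mul, neg_div] using hodd.neg)
  rwa [show Real.pi ^ 2 / 12 = ∑' n : ℕ, 1 / (((2 * n : ℕ) : ℝ) + 1) ^ 2 + -(Real.pi ^ 2 / 24) by
    linarith]

theorem hasSum_alternating_tornheimTerm_row (i : ℕ) :
    HasSum (fun j : ℕ => (-1 : ℝ) ^ (i + j) * tornheimTerm (i, j))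
      (Real.log 2 * ((-1) ^ i / ((i : ℝ) + 1) ^ 2) + Real.log 2 * (1 / ((i : ℝ) + 1) ^ 2)
        - 1 / ((i : ℝ) + 1) ^ 2 * ∑ j ∈ range (i + 1), (-1 : ℝ) ^ j / ((j : ℝ) + 1)) := by
  have hs : Summable fun j : ℕ => (-1 : ℝ) ^ (i + j) * tornheimTerm (i, j) :=
    summable_alternating_tornheimTerm.prod_factor i
  rw [hs.hasSum_iff_tendsto_nat]
  have hL := tendsto_sum_alternating_harmonic
  set g : ℕ → ℝ := fun j => (-1 : ℝ) ^ j / ((j : ℝ) + 1) with hg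
  have hterm : ∀ j, (-1 : ℝ) ^ (i + j) * tornheimTerm (i, j) =
      1 / ((i : ℝ) + 1) ^ 2 * ((-1) ^ i * g j + g (i + 1 + j)) := fun j => by
    simp only [tornheimTerm, hg]
    push_cast
    have : (i : ℝ) + 1 + j + 1 ≠ 0 := by positivity
    have : (i : ℝ) + j + 2 ≠ 0 := by positivity
    rw [pow_add, pow_add, pow_add]
    field_simp
    ring
  have hsum : ∀ n, ∑ j ∈ range n, (-1 : ℝ) ^ (i + j) * tornheimTerm (i, j) =
      1 / ((i : ℝ) + 1) ^ 2 * ((-1) ^ i * ∑ j ∈ range n, g j +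
        (∑ j ∈ range (n + (i + 1)), g j - ∑ j ∈ range (i + 1), g j)) := fun n => by
    rw [sum_congr rfl fun j _ => hterm j, ← mul_sum, sum_add_distrib, ← mul_sum,
      add_comm n, sum_range_add g (i + 1) n]
    ring
  simp_rw [hsum]
  convert! ((hL.const_mul ((-1) ^ i)).add ((hL.comp (tendsto_add_atTop_nat (i + 1))).sub_const
    (∑ j ∈ range (i + 1), g j))).const_mul (1 / ((i : ℝ) + 1) ^ 2) using 2
  ring

theorem sum_Icc_alternating_harmonic (n : ℕ) :
    ∑ k ∈ Finset.Icc 1 n, (-1 : ℝ) ^ (k + 1) / k = ∑ j ∈ range n, (-1 : ℝ) ^ j / ((j : ℝ) + 1) := by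
  induction n with
  | zero => simp
  | succ n ih =>
    rw [sum_Icc_succ_top (by omega), sum_range_succ, ih]
    push_cast
    ring

theorem alt_harmonic_partial_sum_euler :
    HasSum (fun n : ℕ =>
        (1 / ((n : ℝ) + 1) ^ 2)
          * ∑ k ∈ Finset.Icc 1 (n + 1), (-1 : ℝ) ^ (k + 1) / k)
      ((3 / 2) * (Real.pi ^ 2 / 6) * Real.log 2
        - (1 / 4) * ∑' n : ℕ, 1 / ((n : ℝ) + 1) ^ 3) := by
  simp_rw [sum_Icc_alternating_harmonic]
  have h := summable_alternating_tornheimTerm.hasSum.prod_fiberwise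
    hasSum_alternating_tornheimTerm_row
  rw [tsum_alternating_tornheimTerm] at h
  convert! ((hasSum_alternating_one_div_add_one_sq.mul_left (Real.log 2)).add
    (hasSum_one_div_add_one_sq.mul_left (Real.log 2))).sub h using 1
  · ext n; ring
  · ring
end
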